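/- Conservation law for first-type directed lautum information: for any finitely valued jointly distributed X^n and Y^n with p(x^n)p(y^n) > 0 implying p(x^n,y^n) > 0, L(X^n; Y^n) = L₁(X^n → Y^n) + L₁(Y^{n-1} → X^n). -/

import Mathlib

open scoped Classical
open Real

noncomputable section

variable {α β : Type} [Fintype α] [DecidableEq α] [Fintype β] [DecidableEq β]

/-- Probability of the event `E` under the joint pmf `p` of `(X^n, Y^n)`. -/
def pr {n : ℕ} (p : (Fin n → α) → (Fin n → β) → ℝ)
    (E : (Fin n → α) → (Fin n → β) → Prop) : ℝ :=
  ∑ x, ∑ y, if E x y then p x y else 0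

/-- `p` is a probability mass function on pairs of sequences. -/
def IsPmf {n : ℕ} (p : (Fin n → α) → (Fin n → β) → ℝ) : Prop :=
  (∀ x y, 0 ≤ p x y) ∧ ∑ x, ∑ y, p x y = 1

/-- The conditional pmf `p(x_i | x^{i-1}, y^{i-d})` evaluated along `(x, y)`. -/
def condX {n : ℕ} (p : (Fin n → α) → (Fin n → β) → ℝ) (d : ℕ) (i : Fin n)
    (x : Fin n → α) (y : Fin n → β) : ℝ :=
  pr p (fun x' y' => (∀ j, j < i → x' j = x j) ∧ x' i = x i ∧
      ∀ j : Fin n, (j : ℕ) + d ≤ (i : ℕ) → y' j = y j) /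
  pr p (fun x' y' => (∀ j, j < i → x' j = x j) ∧
      ∀ j : Fin n, (j : ℕ) + d ≤ (i : ℕ) → y' j = y j)

/-- The conditional pmf `p(y_i | y^{i-1}, x^{i-d})` evaluated along `(x, y)`. -/
def condY {n : ℕ} (p : (Fin n → α) → (Fin n → β) → ℝ) (d : ℕ) (i : Fin n)
    (x : Fin n → α) (y : Fin n → β) : ℝ :=
  pr p (fun x' y' => (∀ j, j < i → y' j = y j) ∧ y' i = y i ∧
      ∀ j : Fin n, (j : ℕ) + d ≤ (i : ℕ) → x' j = x j) /
  pr p (fun x' y' => (∀ j, j < i → y' j = y j) ∧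
      ∀ j : Fin n, (j : ℕ) + d ≤ (i : ℕ) → x' j = x j)

/-- Causally conditioned pmf `p(x^n || y^{n-d}) = ∏ᵢ p(xᵢ | x^{i-1}, y^{i-d})`. -/
def ccX {n : ℕ} (p : (Fin n → α) → (Fin n → β) → ℝ) (d : ℕ)
    (x : Fin n → α) (y : Fin n → β) : ℝ :=
  ∏ i, condX p d i x y

/-- Causally conditioned pmf `p(y^n || x^{n-d}) = ∏ᵢ p(yᵢ | y^{i-1}, x^{i-d})`. -/
def ccY {n : ℕ} (p : (Fin n → α) → (Fin n → β) → ℝ) (d : ℕ)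
    (x : Fin n → α) (y : Fin n → β) : ℝ :=
  ∏ i, condY p d i x y

/-- Marginal pmf of `X^n`. -/
def pX {n : ℕ} (p : (Fin n → α) → (Fin n → β) → ℝ) (x : Fin n → α) : ℝ := ∑ y, p x y

/-- Marginal pmf of `Y^n`. -/
def pY {n : ℕ} (p : (Fin n → α) → (Fin n → β) → ℝ) (y : Fin n → β) : ℝ := ∑ x, p x y

/-- `H(X^n)` in bits. -/
def HX {n : ℕ} (p : (Fin n → α) → (Fin n → β) → ℝ) : ℝ :=
  -(∑ x, ∑ y, p x y * Real.logb 2 (pX p x))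

/-- `H(Y^n)` in bits. -/
def HY {n : ℕ} (p : (Fin n → α) → (Fin n → β) → ℝ) : ℝ :=
  -(∑ x, ∑ y, p x y * Real.logb 2 (pY p y))

/-- Joint entropy `H(X^n, Y^n)` in bits. -/
def Hjoint {n : ℕ} (p : (Fin n → α) → (Fin n → β) → ℝ) : ℝ :=
  -(∑ x, ∑ y, p x y * Real.logb 2 (p x y))

/-- Conditional entropy `H(X_i | X^{i-1}, Y^{i-d})` in bits. -/
def HcondX {n : ℕ} (p : (Fin n → α) → (Fin n → β) → ℝ) (d : ℕ) (i : Fin n) : ℝ :=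
  -(∑ x, ∑ y, p x y * Real.logb 2 (condX p d i x y))

/-- Conditional entropy `H(Y_i | Y^{i-1}, X^{i-d})` in bits. -/
def HcondY {n : ℕ} (p : (Fin n → α) → (Fin n → β) → ℝ) (d : ℕ) (i : Fin n) : ℝ :=
  -(∑ x, ∑ y, p x y * Real.logb 2 (condY p d i x y))

/-- Causally conditional entropy `H(X^n || Y^{n-d}) = Σᵢ H(Xᵢ | X^{i-1}, Y^{i-d})`. -/
def HccX {n : ℕ} (p : (Fin n → α) → (Fin n → β) → ℝ) (d : ℕ) : ℝ := ∑ i, HcondX p d i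

/-- Causally conditional entropy `H(Y^n || X^{n-d})`. -/
def HccY {n : ℕ} (p : (Fin n → α) → (Fin n → β) → ℝ) (d : ℕ) : ℝ := ∑ i, HcondY p d i

/-- Conditional mutual information `I(Y^i; X_i | X^{i-1})`
(as the expectation of `log (p(xᵢ|x^{i-1},y^i) / p(xᵢ|x^{i-1}))`;
note `condX p n` is `p(xᵢ|x^{i-1})`, conditioning on no `y`'s at all). -/
def cmiYX {n : ℕ} (p : (Fin n → α) → (Fin n → β) → ℝ) (i : Fin n) : ℝ :=
  ∑ x, ∑ y, p x y * Real.logb 2 (condX p 0 i x y / condX p n i x y)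

/-- Conditional mutual information `I(X^i; Y_i | Y^{i-1})`. -/
def cmiXY {n : ℕ} (p : (Fin n → α) → (Fin n → β) → ℝ) (i : Fin n) : ℝ :=
  ∑ x, ∑ y, p x y * Real.logb 2 (condY p 0 i x y / condY p n i x y)

/-- Directed information `I(Y^n → X^n) = Σᵢ I(Y^i; X_i | X^{i-1})`. -/
def dirYX {n : ℕ} (p : (Fin n → α) → (Fin n → β) → ℝ) : ℝ := ∑ i, cmiYX p i

/-- Directed information `I(X^n → Y^n) = Σᵢ I(X^i; Y_i | Y^{i-1})`. -/
def dirXY {n : ℕ} (p : (Fin n → α) → (Fin n → β) → ℝ) : ℝ := ∑ i, cmiXY p i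

/-- Directed information `I(Y^{n-1} → X^n) = Σᵢ I(Y^{i-1}; X_i | X^{i-1})`
(the term for `i = 1` vanishes, so we may sum over all `i`). -/
def dirY1X {n : ℕ} (p : (Fin n → α) → (Fin n → β) → ℝ) : ℝ :=
  ∑ i, ∑ x, ∑ y, p x y * Real.logb 2 (condX p 1 i x y / condX p n i x y)

/-- Mutual information `I(X^n; Y^n)` in bits. -/
def miXY {n : ℕ} (p : (Fin n → α) → (Fin n → β) → ℝ) : ℝ :=
  ∑ x, ∑ y, p x y * Real.logb 2 (p x y / (pX p x * pY p y))

/-- Lautum information `L(X^n; Y^n) = Σ p(x^n)p(y^n) log [p(x^n)p(y^n)/p(x^n,y^n)]`. -/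
def lautum {n : ℕ} (p : (Fin n → α) → (Fin n → β) → ℝ) : ℝ :=
  ∑ x, ∑ y, pX p x * pY p y * Real.logb 2 (pX p x * pY p y / p x y)

/-- First-type directed lautum information
`L₁(X^n → Y^n) = Σ p(x^n)p(y^n) log [p(y^n)/p(y^n||x^n)]`. -/
def lautum1XY {n : ℕ} (p : (Fin n → α) → (Fin n → β) → ℝ) : ℝ :=
  ∑ x, ∑ y, pX p x * pY p y * Real.logb 2 (pY p y / ccY p 0 x y)

/-- First-type directed lautum information
`L₁(Y^{n-1} → X^n) = Σ p(x^n)p(y^n) log [p(x^n)/p(x^n||y^{n-1})]`. -/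
def lautum1Y1X {n : ℕ} (p : (Fin n → α) → (Fin n → β) → ℝ) : ℝ :=
  ∑ x, ∑ y, pX p x * pY p y * Real.logb 2 (pX p x / ccX p 1 x y)

/-- Second-type directed lautum information
`L₂(X^n → Y^n) = Σ p(x^n||y^{n-1})p(y^n) log [p(y^n)/p(y^n||x^n)]`. -/
def lautum2XY {n : ℕ} (p : (Fin n → α) → (Fin n → β) → ℝ) : ℝ :=
  ∑ x, ∑ y, ccX p 1 x y * pY p y * Real.logb 2 (pY p y / ccY p 0 x y)

/-- Probability of agreeing with `x` on the first `k` and with `y` on the first `l` coordinates. -/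
def prefPr {n : ℕ} (p : (Fin n → α) → (Fin n → β) → ℝ) (x : Fin n → α) (y : Fin n → β)
    (k l : ℕ) : ℝ :=
  pr p (fun x' y' => (∀ j : Fin n, (j : ℕ) < k → x' j = x j) ∧
    ∀ j : Fin n, (j : ℕ) < l → y' j = y j)

theorem prefPr_pos {n : ℕ} (p : (Fin n → α) → (Fin n → β) → ℝ) (hp : ∀ x y, 0 ≤ p x y)
    (x : Fin n → α) (y : Fin n → β) (h : 0 < p x y) (k l : ℕ) : 0 < prefPr p x y k l := by
  unfold prefPr pr
  have nn : ∀ (c : Prop) (_ : Decidable c) (x' : Fin n → α) (y' : Fin n → β),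
      0 ≤ (if c then p x' y' else 0) := by
    intro c _ x' y'
    split_ifs
    · exact hp _ _
    · exact le_rfl
  refine Finset.sum_pos' (fun x' _ => Finset.sum_nonneg fun y' _ => nn _ _ x' y')
    ⟨x, Finset.mem_univ _, ?_⟩
  refine Finset.sum_pos' (fun y' _ => nn _ _ x y') ⟨y, Finset.mem_univ _, ?_⟩
  rw [if_pos ⟨fun _ _ => rfl, fun _ _ => rfl⟩]
  exact h

theorem prefPr_zero {n : ℕ} (p : (Fin n → α) → (Fin n → β) → ℝ) (x : Fin n → α)
    (y : Fin n → β) : prefPr p x y 0 0 = ∑ x, ∑ y, p x y := by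
  simp [prefPr, pr]

theorem prefPr_full {n : ℕ} (p : (Fin n → α) → (Fin n → β) → ℝ) (x : Fin n → α)
    (y : Fin n → β) : prefPr p x y n n = p x y := by
  unfold prefPr pr
  rw [Finset.sum_eq_single x, Finset.sum_eq_single y]
  · rw [if_pos ⟨fun _ _ => rfl, fun _ _ => rfl⟩]
  · intro y' _ hy
    rw [if_neg]
    exact fun h => hy (funext fun j => h.2 j j.2)
  · simp
  · intro x' _ hx
    refine Finset.sum_eq_zero fun y' _ => ?_
    rw [if_neg]
    exact fun h => hx (funext fun j => h.1 j j.2)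
  · simp

theorem pr_congr' {n : ℕ} (p : (Fin n → α) → (Fin n → β) → ℝ)
    {E F : (Fin n → α) → (Fin n → β) → Prop} (h : ∀ x y, E x y ↔ F x y) : pr p E = pr p F := by
  have : E = F := by
    funext x y
    exact propext (h x y)
  rw [this]

theorem forall_lt_succ_fin {n : ℕ} {γ : Type} (i : Fin n) (u v : Fin n → γ) :
    (∀ j : Fin n, (j : ℕ) < (i : ℕ) + 1 → u j = v j) ↔
      (∀ j, j < i → u j = v j) ∧ u i = v i := by
  constructor
  · exact fun h => ⟨fun j hj => h j (Nat.lt_succ_of_lt hj), h i (Nat.lt_succ_self _)⟩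
  · rintro ⟨h1, h2⟩ j hj
    rcases Nat.lt_succ_iff_lt_or_eq.mp hj with h | h
    · exact h1 j h
    · rw [Fin.ext h]
      exact h2

theorem condX_one {n : ℕ} (p : (Fin n → α) → (Fin n → β) → ℝ) (i : Fin n) (x : Fin n → α)
    (y : Fin n → β) :
    condX p 1 i x y = prefPr p x y (i + 1) i / prefPr p x y i i := by
  unfold condX prefPr
  congr 1
  refine pr_congr' p fun x' y' => ?_
  rw [forall_lt_succ_fin, and_assoc]
  rfl

theorem condY_zero {n : ℕ} (p : (Fin n → α) → (Fin n → β) → ℝ) (i : Fin n) (x : Fin n → α)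
    (y : Fin n → β) :
    condY p 0 i x y = prefPr p x y (i + 1) (i + 1) / prefPr p x y (i + 1) i := by
  have key : ∀ x' : Fin n → α, (∀ j : Fin n, (j : ℕ) + 0 ≤ (i : ℕ) → x' j = x j) ↔
      ∀ j : Fin n, (j : ℕ) < (i : ℕ) + 1 → x' j = x j := by
    intro x'
    simp only [add_zero, Nat.lt_succ_iff]
  unfold condY prefPr
  congr 1
  · refine pr_congr' p fun x' y' => ?_
    rw [forall_lt_succ_fin i y' y, key, ← and_assoc, and_comm]
  · refine pr_congr' p fun x' y' => ?_
    rw [key, and_comm]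
    rfl

theorem ccY_mul_ccX {n : ℕ} (p : (Fin n → α) → (Fin n → β) → ℝ) (hp : IsPmf p)
    (x : Fin n → α) (y : Fin n → β) (h : 0 < p x y) : ccY p 0 x y * ccX p 1 x y = p x y := by
  have pos := prefPr_pos p hp.1 x y h
  unfold ccY ccX
  rw [← Finset.prod_mul_distrib]
  have h1 : ∀ i : Fin n, condY p 0 i x y * condX p 1 i x y =
      (fun m : ℕ => prefPr p x y (m + 1) (m + 1) / prefPr p x y m m) i := by
    intro i
    rw [condX_one, condY_zero]
    have a := (pos (i + 1) i).ne'
    have b := (pos i i).ne'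
    field_simp
  rw [Finset.prod_congr rfl fun i _ => h1 i,
    Fin.prod_univ_eq_prod_range (fun m : ℕ => prefPr p x y (m + 1) (m + 1) / prefPr p x y m m)]
  have tel : ∀ N : ℕ, ∏ m ∈ Finset.range N,
      prefPr p x y (m + 1) (m + 1) / prefPr p x y m m = prefPr p x y N N := by
    intro N
    induction N with
    | zero => rw [prefPr_zero, hp.2, Finset.prod_range_zero]
    | succ N ih =>
      rw [Finset.prod_range_succ, ih]
      have b := (pos N N).ne'
      field_simp
  rw [tel, prefPr_full]

/-- conservation law for first-type directed lautum information:
`L(X^n; Y^n) = L₁(X^n → Y^n) + L₁(Y^{n-1} → X^n)`, whenever `p(x^n)p(y^n) > 0`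
implies `p(x^n,y^n) > 0`. -/
theorem lautum_conservation_law {n : ℕ}
    (p : (Fin n → α) → (Fin n → β) → ℝ) (hp : IsPmf p)
    (hsupp : ∀ x y, 0 < pX p x * pY p y → 0 < p x y) :
    lautum p = lautum1XY p + lautum1Y1X p := by
  unfold lautum lautum1XY lautum1Y1X
  rw [← Finset.sum_add_distrib]
  refine Finset.sum_congr rfl fun x _ => ?_
  rw [← Finset.sum_add_distrib]
  refine Finset.sum_congr rfl fun y _ => ?_
  have hX : 0 ≤ pX p x := Finset.sum_nonneg fun y _ => hp.1 x y
  have hY : 0 ≤ pY p y := Finset.sum_nonneg fun x _ => hp.1 x y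
  rcases (mul_nonneg hX hY).eq_or_lt with h0 | h0
  · rw [← h0]
    simp
  · have hpos := hsupp x y h0
    have hcc := ccY_mul_ccX p hp x y hpos
    have hne : ccY p 0 x y * ccX p 1 x y ≠ 0 := by
      rw [hcc]
      exact hpos.ne'
    have hcy := left_ne_zero_of_mul hne
    have hcx := right_ne_zero_of_mul hne
    have hx := left_ne_zero_of_mul h0.ne'
    have hy := right_ne_zero_of_mul h0.ne'
    rw [← mul_add, ← Real.logb_mul (div_ne_zero hy hcy) (div_ne_zero hx hcx),
      div_mul_div_comm, hcc, mul_comm (pY p y)]
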